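/- arXiv:2210.00027 — 3 statements merged into one kernel-verified Lean document; each statement's English description precedes it below -/
import Mathlib

section
/- Let p ∈ (1, ∞). For every sequence (a_n) in ℓ^p(ℤ) and every n ∈ ℤ, one has 𝓗 a_n = 𝓘[𝓚 a]_n = 𝓚[𝓘 a]_n; that is, 𝓗 = 𝓘 ∘ 𝓚 = 𝓚 ∘ 𝓘 on ℓ^p(ℤ). -/
open scoped BigOperators
open MeasureTheory

noncomputable section

/-- The ℓ^p norm of a doubly infinite complex sequence. -/
def lpNorm (p : ℝ) (a : ℤ → ℂ) : ℝ := (∑' n : ℤ, ‖a n‖ ^ p) ^ (1 / p)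

/-- Membership in ℓ^p(ℤ). -/
def MemLpZ (p : ℝ) (a : ℤ → ℂ) : Prop := Summable fun n : ℤ => ‖a n‖ ^ p

/-- The operator norm of an operator on ℓ^p(ℤ): the least admissible constant. -/
def opNormOn (p : ℝ) (T : (ℤ → ℂ) → ℤ → ℂ) : ℝ :=
  sInf {C : ℝ | 0 ≤ C ∧ ∀ a : ℤ → ℂ, MemLpZ p a → lpNorm p (T a) ≤ C * lpNorm p a}

/-- The Riesz–Titchmarsh operator: 𝓡 a_n = (1/π) Σ_{m ∈ ℤ} a_{n-m}/(m + 1/2). -/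
def RT (a : ℤ → ℂ) (n : ℤ) : ℂ :=
  (1 / (Real.pi : ℂ)) * ∑' m : ℤ, a (n - m) / ((m : ℂ) + 1 / 2)

/-- The Kak–Hilbert transform: 𝓚 a_n = (2/π) Σ_{m odd} a_{n-m}/m. -/
def KT (a : ℤ → ℂ) (n : ℤ) : ℂ :=
  (2 / (Real.pi : ℂ)) * ∑' m : {m : ℤ // Odd m}, a (n - (m : ℤ)) / ((m : ℤ) : ℂ)

/-- The discrete Hilbert transform: 𝓗₀ a_n = (1/π) Σ_{m ≠ 0} a_{n-m}/m. -/
def H0T (a : ℤ → ℂ) (n : ℤ) : ℂ :=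
  (1 / (Real.pi : ℂ)) * ∑' m : {m : ℤ // m ≠ 0}, a (n - (m : ℤ)) / ((m : ℤ) : ℂ)

/-- The operator 𝓗: 𝓗 a_n = (2/π) Σ_{m even, m ≠ 0} a_{n-m}/m. -/
def HT (a : ℤ → ℂ) (n : ℤ) : ℂ :=
  (2 / (Real.pi : ℂ)) *
    ∑' m : {m : ℤ // Even (m : ℤ) ∧ (m : ℤ) ≠ 0}, a (n - (m : ℤ)) / ((m : ℤ) : ℂ)

/-- The operator 𝓘: 𝓘 a_n = (4/π²) Σ_{m odd} a_{n-m}/m². -/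
def IT (a : ℤ → ℂ) (n : ℤ) : ℂ :=
  (4 / (Real.pi : ℂ) ^ 2) * ∑' m : {m : ℤ // Odd m}, a (n - (m : ℤ)) / ((m : ℤ) : ℂ) ^ 2

/-- p* = max(p, p/(p-1)). -/
def pstar (p : ℝ) : ℝ := max p (p / (p - 1))

/-- C_p = cot(π/(2 p*)). -/
def Cconst (p : ℝ) : ℝ := Real.cot (Real.pi / (2 * pstar p))

/-- The kernel `1/m` on odd integers, extended by zero. -/
def oddInv (m : ℤ) : ℝ := if Odd m then (m : ℝ)⁻¹ else 0

/-- The kernel `1/m` on even integers, with value zero at `m = 0`. -/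
def evenInv (m : ℤ) : ℝ := if Even m then (m : ℝ)⁻¹ else 0

lemma oddInv_neg (m : ℤ) : oddInv (-m) = -oddInv m := by
  unfold oddInv
  by_cases h : Odd m <;> simp [h, inv_neg]

lemma KT_eq_tsum (a : ℤ → ℂ) (n : ℤ) :
    KT a n = (2 / (Real.pi : ℂ)) * ∑' m : ℤ, a (n - m) * (oddInv m : ℂ) := by
  unfold KT
  congr 1
  refine (tsum_subtype {m : ℤ | Odd m} (fun m : ℤ => a (n - m) / (m : ℂ))).trans ?_
  refine tsum_congr fun m => ?_
  by_cases h : Odd m <;> simp [Set.indicator, oddInv, h, div_eq_mul_inv]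

lemma IT_eq_tsum (a : ℤ → ℂ) (n : ℤ) :
    IT a n = (4 / (Real.pi : ℂ) ^ 2) * ∑' m : ℤ, a (n - m) * (oddInv m : ℂ) ^ 2 := by
  unfold IT
  congr 1
  refine (tsum_subtype {m : ℤ | Odd m} (fun m : ℤ => a (n - m) / (m : ℂ) ^ 2)).trans ?_
  refine tsum_congr fun m => ?_
  by_cases h : Odd m <;> simp [Set.indicator, oddInv, h, div_eq_mul_inv]

lemma HT_eq_tsum (a : ℤ → ℂ) (n : ℤ) :
    HT a n = (2 / (Real.pi : ℂ)) * ∑' m : ℤ, a (n - m) * (evenInv m : ℂ) := by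
  unfold HT
  congr 1
  refine (tsum_subtype {m : ℤ | Even m ∧ m ≠ 0} (fun m : ℤ => a (n - m) / (m : ℂ))).trans ?_
  refine tsum_congr fun m => ?_
  by_cases h : Even m <;> by_cases h0 : m = 0 <;>
    simp [Set.indicator, evenInv, h, h0, div_eq_mul_inv]

lemma summable_abs_oddInv_rpow {q : ℝ} (hq : 1 < q) :
    Summable fun m : ℤ => |oddInv m| ^ q := by
  refine Summable.of_nonneg_of_le (fun m => by positivity) (fun m => ?_)
    (Real.summable_abs_int_rpow hq)
  unfold oddInv
  split_ifs
  · rw [abs_inv, Real.inv_rpow (abs_nonneg _), Real.rpow_neg (abs_nonneg _)]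
  · rw [abs_zero, Real.zero_rpow (by linarith)]
    positivity

lemma hasSum_int_inv_sq : HasSum (fun m : ℤ => ((m : ℝ) ^ 2)⁻¹) (Real.pi ^ 2 / 3) := by
  have h := hasSum_zeta_two
  have h' := HasSum.of_nat_of_neg (f := fun m : ℤ => ((m : ℝ) ^ 2)⁻¹) (by simpa using h)
    (by simpa using h)
  convert h' using 1
  · rfl
  · simp
    ring

lemma hasSum_oddInv_sq : HasSum (fun m : ℤ => oddInv m ^ 2) (Real.pi ^ 2 / 4) := by
  have hall := hasSum_int_inv_sq
  have heven : HasSum (fun m : ℤ => if Even m then ((m : ℝ) ^ 2)⁻¹ else 0) (Real.pi ^ 2 / 12) := by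
    have hinj : Function.Injective fun k : ℤ => 2 * k := fun x y h => by simpa using h
    refine (hinj.hasSum_iff ?_).mp ?_
    · intro m hm
      refine if_neg fun h => hm ?_
      obtain ⟨k, rfl⟩ := even_iff_two_dvd.mp h
      exact ⟨k, rfl⟩
    · convert hall.mul_left (1 / 4 : ℝ) using 1
      · rfl
      · ext k
        simp [mul_pow]
        ring
      · ring
  convert hall.sub heven using 1
  · rfl
  · ext m
    by_cases h : Even m
    · simp [oddInv, h]
    · simp [oddInv, h, Int.not_even_iff_odd.mp h]
  · ring

lemma summable_mul_of_summable_sq {ι : Type*} {f g : ι → ℝ} (hf : Summable fun i => f i ^ 2)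
    (hg : Summable fun i => g i ^ 2) : Summable fun i => f i * g i := by
  refine Summable.of_norm_bounded (hf.add hg) fun i => ?_
  rw [Real.norm_eq_abs, abs_le]
  constructor <;> nlinarith [sq_nonneg (f i + g i), sq_nonneg (f i - g i)]

open Filter Topology in
lemma hasSum_int_sub_pred_eq_zero {G : ℤ → ℝ} (hG : Tendsto G cofinite (𝓝 0))
    (hs : Summable fun m : ℤ => G m - G (m - 1)) : HasSum (fun m : ℤ => G m - G (m - 1)) 0 := by
  have hpos : HasSum (fun n : ℕ => G n - G (n - 1)) (-G (-1)) := by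
    have h1 : Summable fun n : ℕ => G n - G (n - 1) :=
      hs.comp_injective (i := fun n : ℕ => (n : ℤ)) Nat.cast_injective
    refine (h1.hasSum_iff_tendsto_nat).mpr ?_
    have h2 : ∀ N : ℕ, ∑ n ∈ Finset.range N, (G n - G (n - 1)) = G ((N : ℤ) - 1) - G (-1) := by
      intro N
      have := Finset.sum_range_sub (fun n : ℕ => G ((n : ℤ) - 1)) N
      simpa using this
    simp_rw [h2]
    have hinj : Function.Injective fun N : ℕ => (N : ℤ) - 1 := fun x y h => by simpa using h
    have h3 := hG.comp hinj.tendsto_cofinite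
    rw [Nat.cofinite_eq_atTop] at h3
    simpa using h3.sub_const (G (-1))
  have hneg : HasSum (fun n : ℕ => G (-(n + 1 : ℤ)) - G (-(n + 1 : ℤ) - 1)) (G (-1)) := by
    have hinj : Function.Injective fun N : ℕ => -((N : ℤ) + 1) := fun x y h => by simpa using h
    have h1 : Summable fun n : ℕ => G (-(n + 1 : ℤ)) - G (-(n + 1 : ℤ) - 1) :=
      hs.comp_injective hinj
    refine (h1.hasSum_iff_tendsto_nat).mpr ?_
    have h2 : ∀ N : ℕ, ∑ n ∈ Finset.range N, (G (-(n + 1 : ℤ)) - G (-(n + 1 : ℤ) - 1)) =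
        G (-1) - G (-((N : ℤ) + 1)) := by
      intro N
      have := Finset.sum_range_sub' (fun n : ℕ => G (-((n : ℤ) + 1))) N
      simpa [sub_eq_add_neg, add_comm, add_left_comm] using this
    simp_rw [h2]
    have h3 := hG.comp hinj.tendsto_cofinite
    rw [Nat.cofinite_eq_atTop] at h3
    simpa using h3.const_sub (G (-1))
  simpa using HasSum.of_nat_of_neg_add_one (f := fun m : ℤ => G m - G (m - 1)) hpos hneg

open Filter Topology in
lemma tendsto_oddInv : Tendsto oddInv cofinite (𝓝 0) := by
  have h := hasSum_oddInv_sq.summable.tendsto_cofinite_zero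
  have h2 := (Real.continuous_sqrt.tendsto 0).comp h
  simp only [Real.sqrt_zero, Function.comp_def, Real.sqrt_sq_eq_abs] at h2
  exact (tendsto_zero_iff_abs_tendsto_zero _).mpr h2

lemma oddInv_sub_oddInv_sub {l : ℤ} (hl : Even l) (m : ℤ) :
    oddInv m - oddInv (m - l) = -l * (oddInv m * oddInv (m - l)) := by
  by_cases h : Odd m
  · have h' : Odd (m - l) := h.sub_even hl
    have h0 : (m : ℝ) ≠ 0 := by
      rintro h0
      simp [Int.cast_eq_zero.mp h0] at h
    have h1 : (m : ℝ) - l ≠ 0 := by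
      intro h1
      rw [show m - l = 0 by exact_mod_cast h1] at h'
      simp at h'
    simp only [oddInv, h, h', if_true]
    push_cast
    field_simp
    ring
  · have h' : ¬ Odd (m - l) := fun h' => h (by simpa using h'.add_even hl)
    simp [oddInv, h, h']

lemma hasSum_oddInv_sub_two : HasSum (fun m : ℤ => oddInv m - oddInv (m - 2)) 0 := by
  have hinj (l : ℤ) : Function.Injective fun m : ℤ => m - l := sub_left_injective
  have hs : Summable fun m : ℤ => oddInv m - oddInv (m - 2) := by
    simp_rw [oddInv_sub_oddInv_sub even_two]
    exact (summable_mul_of_summable_sq hasSum_oddInv_sq.summable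
      (hasSum_oddInv_sq.summable.comp_injective (hinj 2))).mul_left _
  have hG := tendsto_oddInv.add (tendsto_oddInv.comp (hinj 1).tendsto_cofinite)
  have heq : (fun m : ℤ => oddInv m - oddInv (m - 2)) =
      fun m : ℤ => (oddInv m + oddInv (m - 1)) - (oddInv (m - 1) + oddInv (m - 1 - 1)) := by
    ext m
    rw [show m - 1 - 1 = m - 2 by ring]
    ring
  rw [heq] at hs ⊢
  exact hasSum_int_sub_pred_eq_zero (G := fun m => oddInv m + oddInv (m - 1))
    (by simpa using hG) hs

lemma hasSum_oddInv_sub {l : ℤ} (hl : Even l) :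
    HasSum (fun m : ℤ => oddInv m - oddInv (m - l)) 0 := by
  obtain ⟨j, rfl⟩ := even_iff_two_dvd.mp hl
  clear hl
  induction j using Int.induction_on with
  | zero => simp
  | succ j ih =>
    have h := hasSum_oddInv_sub_two.add ((Equiv.subRight (2 : ℤ)).hasSum_iff.mpr ih)
    convert h using 1
    · ext m
      simp only [Function.comp_apply, Equiv.subRight_apply]
      rw [show m - 2 * ((j : ℤ) + 1) = m - 2 - 2 * j by ring]
      ring
    · simp
  | pred j ih =>
    have h := (Equiv.addRight (2 : ℤ)).hasSum_iff.mpr (ih.sub hasSum_oddInv_sub_two)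
    convert h using 1
    · rfl
    · ext m
      simp only [Function.comp_apply, Equiv.coe_addRight]
      rw [show m - 2 * (-(j : ℤ) - 1) = m + 2 - 2 * -j by ring, add_sub_cancel_right]
      ring
    · simp

lemma tsum_oddInv_sub_mul_sq (l : ℤ) :
    ∑' m : ℤ, oddInv (l - m) * oddInv m ^ 2 = Real.pi ^ 2 / 4 * evenInv l := by
  by_cases hl : Even l
  · by_cases h0 : l = 0
    · subst h0
      have h := (Equiv.neg ℤ).tsum_eq fun m : ℤ => oddInv (0 - m) * oddInv m ^ 2
      simp only [Equiv.neg_apply, zero_sub, oddInv_neg, neg_sq, neg_mul, neg_neg, tsum_neg] at h ⊢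
      simp only [evenInv, Int.cast_zero, inv_zero, ite_self, mul_zero]
      linarith
    · have hl0 : (l : ℝ) ≠ 0 := by exact_mod_cast h0
      have h := (hasSum_oddInv_sq.mul_left (l : ℝ)⁻¹).add
        ((hasSum_oddInv_sub hl).mul_left ((l : ℝ) ^ 2)⁻¹)
      have heq : (fun m : ℤ => oddInv (l - m) * oddInv m ^ 2) = fun m : ℤ =>
          (l : ℝ)⁻¹ * oddInv m ^ 2 + ((l : ℝ) ^ 2)⁻¹ * (oddInv m - oddInv (m - l)) := by
        ext m
        have h1 := oddInv_sub_oddInv_sub hl m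
        rw [← neg_sub m l, oddInv_neg]
        field_simp
        linear_combination (-(l : ℝ) * oddInv m - 1) * h1
      rw [heq, h.tsum_eq]
      simp [evenInv, hl]
      ring
  · have hz : ∀ m : ℤ, oddInv (l - m) * oddInv m ^ 2 = 0 := by
      intro m
      by_cases hm : Odd m
      · have : ¬ Odd (l - m) := Int.not_odd_iff_even.mpr ((Int.not_even_iff_odd.mp hl).sub_odd hm)
        simp [oddInv, this]
      · simp [oddInv, hm]
    simp [hz, evenInv, hl]

lemma summable_oddInv_sq_mul_oddInv_mul {p : ℝ} (hp : 1 < p) {a : ℤ → ℂ} (ha : MemLpZ p a)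
    (n : ℤ) : Summable fun x : ℤ × ℤ =>
      a (n - x.1 - x.2) * (oddInv x.2 : ℂ) * (oddInv x.1 : ℂ) ^ 2 := by
  have hpq := Real.HolderConjugate.conjExponent hp
  have ha' : Summable fun m : ℤ => ‖a m‖ ^ p := ha
  generalize Real.conjExponent p = q at hpq
  have hi := hasSum_oddInv_sq.summable
  have hi0 : 0 ≤ fun m : ℤ => oddInv m ^ 2 := fun m => sq_nonneg (oddInv m)
  have ha0 : 0 ≤ fun m : ℤ => ‖a m‖ ^ p := fun m => Real.rpow_nonneg (norm_nonneg (a m)) p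
  have hk0 : 0 ≤ fun m : ℤ => |oddInv m| ^ q := fun m => Real.rpow_nonneg (abs_nonneg (oddInv m)) q
  have h1 : Summable fun x : ℤ × ℤ => oddInv x.1 ^ 2 * ‖a (n - x.1 - x.2)‖ ^ p := by
    have h := hi.mul_of_nonneg ha' hi0 ha0
    let e : ℤ × ℤ ≃ ℤ × ℤ :=
      Equiv.prodShear (Equiv.refl ℤ) fun m => Equiv.subLeft (n - m)
    exact (e.summable_iff.mpr h).congr fun x => rfl
  have h2 : Summable fun x : ℤ × ℤ => oddInv x.1 ^ 2 * |oddInv x.2| ^ q :=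
    hi.mul_of_nonneg (summable_abs_oddInv_rpow hpq.symm.lt) hi0 hk0
  refine Summable.of_norm_bounded ((h1.div_const p).add (h2.div_const q)) fun x => ?_
  have hy := Real.young_inequality_of_nonneg (norm_nonneg (a (n - x.1 - x.2)))
    (abs_nonneg (oddInv x.2)) hpq
  rw [norm_mul, norm_mul, norm_pow, Complex.norm_real, Complex.norm_real, Real.norm_eq_abs,
    Real.norm_eq_abs, sq_abs]
  calc _ ≤ _ := mul_le_mul_of_nonneg_right hy (sq_nonneg (oddInv x.1))
    _ = _ := by ring

/-- 𝓗 = 𝓘 ∘ 𝓚 = 𝓚 ∘ 𝓘 on ℓ^p(ℤ). -/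
theorem HT_eq_IT_KT (p : ℝ) (hp : 1 < p) (a : ℤ → ℂ) (ha : MemLpZ p a) (n : ℤ) :
    HT a n = IT (KT a) n ∧ IT (KT a) n = KT (IT a) n := by
  have hF := summable_oddInv_sq_mul_oddInv_mul hp ha n
  have hshear : Summable fun x : ℤ × ℤ =>
      a (n - x.2) * (oddInv (x.2 - x.1) : ℂ) * (oddInv x.1 : ℂ) ^ 2 := by
    have h := (Equiv.prodShear (Equiv.refl ℤ) fun m : ℤ => Equiv.subRight m).summable_iff.mpr hF
    refine h.congr fun x => ?_
    simp [Equiv.prodShear]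
  have hIK : IT (KT a) n = (4 / (Real.pi : ℂ) ^ 2) * ((2 / (Real.pi : ℂ)) *
      ∑' m : ℤ, ∑' k : ℤ, a (n - m - k) * (oddInv k : ℂ) * (oddInv m : ℂ) ^ 2) := by
    simp_rw [IT_eq_tsum, KT_eq_tsum, mul_assoc, tsum_mul_left, ← mul_assoc, tsum_mul_right]
  have hKI : KT (IT a) n = (2 / (Real.pi : ℂ)) * ((4 / (Real.pi : ℂ) ^ 2) *
      ∑' k : ℤ, ∑' m : ℤ, a (n - m - k) * (oddInv k : ℂ) * (oddInv m : ℂ) ^ 2) := by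
    simp_rw [KT_eq_tsum, IT_eq_tsum, mul_assoc, tsum_mul_left, ← tsum_mul_right]
    congr 2
    refine tsum_congr fun k => tsum_congr fun m => ?_
    rw [sub_right_comm n]
    ring
  constructor
  · have hsum : ∑' m : ℤ, ∑' k : ℤ, a (n - m - k) * (oddInv k : ℂ) * (oddInv m : ℂ) ^ 2 =
        (Real.pi : ℂ) ^ 2 / 4 * ∑' l : ℤ, a (n - l) * (evenInv l : ℂ) := by
      calc _ = ∑' m : ℤ, ∑' l : ℤ, a (n - l) * (oddInv (l - m) : ℂ) * (oddInv m : ℂ) ^ 2 := by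
            refine tsum_congr fun m => ?_
            rw [← (Equiv.subRight m).tsum_eq]
            simp
        _ = ∑' l : ℤ, ∑' m : ℤ, a (n - l) * (oddInv (l - m) : ℂ) * (oddInv m : ℂ) ^ 2 :=
            (Summable.tsum_comm (f := fun m l : ℤ =>
              a (n - l) * (oddInv (l - m) : ℂ) * (oddInv m : ℂ) ^ 2) hshear).symm
        _ = ∑' l : ℤ, (Real.pi : ℂ) ^ 2 / 4 * (a (n - l) * (evenInv l : ℂ)) := by
            refine tsum_congr fun l => ?_
            have h := congrArg (fun x : ℝ => (x : ℂ)) (tsum_oddInv_sub_mul_sq l)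
            push_cast at h
            simp_rw [mul_assoc, tsum_mul_left, h]
            ring
        _ = _ := tsum_mul_left
    have hpi : (Real.pi : ℂ) ≠ 0 := by exact_mod_cast Real.pi_ne_zero
    rw [hIK, hsum, HT_eq_tsum]
    field_simp
  · rw [hIK, hKI, Summable.tsum_comm (f := fun m k : ℤ =>
      a (n - m - k) * (oddInv k : ℂ) * (oddInv m : ℂ) ^ 2) hF]
    ring

end
end

section
/- Let p ∈ (1, ∞). For all sequences (a_n) and (b_n) in ℓ^p(ℤ) and every n ∈ ℤ, the product rule 𝓚a_n · 𝓚b_n = 𝓚[(a · 𝓗b)]_n + 𝓚[(𝓗a · b)]_n + 𝓘[(a · b)]_n holds, where (a · 𝓗b), (𝓗a · b) and (a · b) denote the sequences with entries a_n · 𝓗b_n, 𝓗a_n · b_n and a_n · b_n respectively. -/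
open scoped BigOperators
open MeasureTheory

noncomputable section

/-- Reflecting and translating a sequence preserves membership in ℓ^p(ℤ). -/
lemma MemLpZ.comp_sub_left {p : ℝ} {a : ℤ → ℂ} (ha : MemLpZ p a) (n : ℤ) :
    MemLpZ p fun m => a (n - m) :=
  (Equiv.subLeft n).summable_iff.mpr ha

/-- By Hölder's inequality, the pairing of an ℓ^p sequence with the translates of `1 / |m|`
converges absolutely and is bounded uniformly in the translation. -/
lemma MemLpZ.exists_hilbert_bound {p : ℝ} (hp : 1 < p) {b : ℤ → ℂ} (hb : MemLpZ p b) :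
    ∃ C : ℝ, ∀ s : ℤ, Summable (fun t : ℤ => ‖b t / ((t : ℂ) - s)‖) ∧
      ∑' t : ℤ, ‖b t / ((t : ℂ) - s)‖ ≤ C := by
  have hpq := Real.HolderConjugate.conjExponent hp
  set q := p.conjExponent
  have hw : Summable fun m : ℤ => (|(m : ℝ)|⁻¹) ^ q :=
    (Real.summable_abs_int_rpow hpq.symm.lt).congr fun m => by
      rw [Real.rpow_neg (abs_nonneg _), Real.inv_rpow (abs_nonneg _)]
  refine ⟨(∑' t, ‖b t‖ ^ p) ^ (1 / p) * (∑' m : ℤ, (|(m : ℝ)|⁻¹) ^ q) ^ (1 / q), fun s => ?_⟩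
  have hnorm : (fun t : ℤ => ‖b t / ((t : ℂ) - s)‖) =
      fun t : ℤ => ‖b t‖ * |((t - s : ℤ) : ℝ)|⁻¹ := by
    funext t
    rw [norm_div, div_eq_mul_inv, ← Int.cast_sub, Complex.norm_intCast]
  have hws : Summable fun t : ℤ => (|((t - s : ℤ) : ℝ)|⁻¹) ^ q :=
    (Equiv.subRight s).summable_iff.mpr hw
  have hsum : ∑' t : ℤ, (|((t - s : ℤ) : ℝ)|⁻¹) ^ q = ∑' m : ℤ, (|(m : ℝ)|⁻¹) ^ q :=
    (Equiv.subRight s).tsum_eq fun m : ℤ => (|(m : ℝ)|⁻¹) ^ q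
  rw [hnorm, ← hsum]
  exact Real.summable_and_inner_le_Lp_mul_Lq_tsum_of_nonneg hpq (fun _ => norm_nonneg _)
    (fun _ => by positivity) hb hws

lemma MemLpZ.summable_norm_div {p : ℝ} (hp : 1 < p) {a : ℤ → ℂ} (ha : MemLpZ p a) :
    Summable fun s : ℤ => ‖a s / (s : ℂ)‖ := by
  obtain ⟨C, hC⟩ := ha.exists_hilbert_bound hp
  simpa using (hC 0).1

lemma MemLpZ.summable_norm_odd_div {p : ℝ} (hp : 1 < p) {a : ℤ → ℂ} (ha : MemLpZ p a) (n : ℤ) :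
    Summable fun s : {m : ℤ // Odd m} => ‖a (n - s) / ((s : ℤ) : ℂ)‖ := by
  simpa only [Function.comp_def] using
    ((ha.comp_sub_left n).summable_norm_div hp).comp_injective
      (Subtype.val_injective (p := fun m : ℤ => Odd m))

/-- The double series of an iterated Hilbert-type pairing converges absolutely. -/
lemma MemLpZ.summable_div_mul_div_sub {p : ℝ} (hp : 1 < p) {a b : ℤ → ℂ}
    (ha : MemLpZ p a) (hb : MemLpZ p b) :
    Summable fun x : ℤ × ℤ => a x.1 / (x.1 : ℂ) * (b x.2 / ((x.2 : ℂ) - x.1)) := by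
  obtain ⟨C, hC⟩ := hb.exists_hilbert_bound hp
  refine Summable.of_norm ?_
  rw [summable_prod_of_nonneg fun _ => norm_nonneg _]
  simp only [norm_mul]
  refine ⟨fun s => (hC s).1.mul_left _, ?_⟩
  refine ((ha.summable_norm_div hp).mul_right C).of_nonneg_of_le
    (fun s => tsum_nonneg fun t => by positivity) fun s => ?_
  rw [tsum_mul_left]
  exact mul_le_mul_of_nonneg_left (hC s).2 (norm_nonneg _)

lemma HT_sub_odd (b : ℤ → ℂ) (n : ℤ) (s : {m : ℤ // Odd m}) :
    HT b (n - s) = (2 / (Real.pi : ℂ)) *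
      ∑' t : {m : ℤ // Odd m}, b (n - t) / (((t : ℤ) : ℂ) - ((s : ℤ) : ℂ)) := by
  let shift : {m : ℤ // Even m ∧ m ≠ 0} → {m : ℤ // Odd m} :=
    fun m => ⟨s + m, s.2.add_even m.2.1⟩
  have hinj : Function.Injective shift := fun x y h => by
    have : (s : ℤ) + x = s + y := congrArg Subtype.val h
    exact Subtype.ext (add_left_cancel this)
  rw [HT, ← hinj.tsum_eq]
  · congr 1
    refine tsum_congr fun m => ?_
    simp [shift, sub_sub]
  · intro t ht
    have hne : (t : ℤ) - s ≠ 0 := fun h => ht (by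
      simp only [← Int.cast_sub, h, Int.cast_zero, div_zero])
    exact ⟨⟨t - s, t.2.sub_odd s.2, hne⟩, Subtype.ext (add_sub_cancel _ _)⟩

lemma MemLpZ.summable_odd_div_mul_div_sub {p : ℝ} (hp : 1 < p) {a b : ℤ → ℂ}
    (ha : MemLpZ p a) (hb : MemLpZ p b) (n : ℤ) :
    Summable fun x : {m : ℤ // Odd m} × {m : ℤ // Odd m} =>
      a (n - x.1) / ((x.1 : ℤ) : ℂ) *
        (b (n - x.2) / (((x.2 : ℤ) : ℂ) - ((x.1 : ℤ) : ℂ))) := by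
  have hs := (ha.comp_sub_left n).summable_div_mul_div_sub hp (hb.comp_sub_left n)
  have hinj : Function.Injective (fun x : {m : ℤ // Odd m} × {m : ℤ // Odd m} =>
      ((x.1 : ℤ), (x.2 : ℤ))) :=
    Subtype.val_injective.prodMap Subtype.val_injective
  simpa only [Function.comp_def] using hs.comp_injective hinj

/-- 𝓚[a · 𝓗b] as an absolutely convergent double series. -/
lemma KT_mul_HT_eq_tsum_prod {p : ℝ} (hp : 1 < p) {a b : ℤ → ℂ}
    (ha : MemLpZ p a) (hb : MemLpZ p b) (n : ℤ) :
    KT (fun m => a m * HT b m) n = (4 / (Real.pi : ℂ) ^ 2) *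
      ∑' x : {m : ℤ // Odd m} × {m : ℤ // Odd m},
        a (n - x.1) / ((x.1 : ℤ) : ℂ) * (b (n - x.2) / (((x.2 : ℤ) : ℂ) - ((x.1 : ℤ) : ℂ))) := by
  rw [(ha.summable_odd_div_mul_div_sub hp hb n).tsum_prod, KT, ← tsum_mul_left, ← tsum_mul_left]
  refine tsum_congr fun s => ?_
  dsimp only
  rw [HT_sub_odd, tsum_mul_left]
  ring

/-- The product rule: 𝓚a · 𝓚b = 𝓚[a · 𝓗b] + 𝓚[𝓗a · b] + 𝓘[a · b]. -/
theorem product_rule (p : ℝ) (hp : 1 < p) (a b : ℤ → ℂ)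
    (ha : MemLpZ p a) (hb : MemLpZ p b) (n : ℤ) :
    KT a n * KT b n =
      KT (fun m => a m * HT b m) n + KT (fun m => HT a m * b m) n +
        IT (fun m => a m * b m) n := by
  let F : {m : ℤ // Odd m} × {m : ℤ // Odd m} → ℂ := fun x =>
    a (n - x.1) / ((x.1 : ℤ) : ℂ) * (b (n - x.2) / ((x.2 : ℤ) : ℂ))
  let G : {m : ℤ // Odd m} × {m : ℤ // Odd m} → ℂ := fun x =>
    a (n - x.1) / ((x.1 : ℤ) : ℂ) * (b (n - x.2) / (((x.2 : ℤ) : ℂ) - ((x.1 : ℤ) : ℂ)))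
  let H : {m : ℤ // Odd m} × {m : ℤ // Odd m} → ℂ := fun x =>
    b (n - x.1) / ((x.1 : ℤ) : ℂ) * (a (n - x.2) / (((x.2 : ℤ) : ℂ) - ((x.1 : ℤ) : ℂ)))
  let D : {m : ℤ // Odd m} × {m : ℤ // Odd m} → ℂ := fun x =>
    if x.2 = x.1 then a (n - x.1) * b (n - x.1) / ((x.1 : ℤ) : ℂ) ^ 2 else 0
  have hdecomp : ∀ x, F x = G x + H x.swap + D x := by
    rintro ⟨s, t⟩
    have hs0 : ((s : ℤ) : ℂ) ≠ 0 := Int.cast_ne_zero.mpr fun h => by simpa [h] using s.2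
    have ht0 : ((t : ℤ) : ℂ) ≠ 0 := Int.cast_ne_zero.mpr fun h => by simpa [h] using t.2
    by_cases hst : t = s
    · subst hst
      simp only [F, G, H, D, Prod.swap, sub_self, div_zero, mul_zero, zero_add, if_true]
      field_simp
    · have hne : ((t : ℤ) : ℂ) - ((s : ℤ) : ℂ) ≠ 0 := by
        rw [sub_ne_zero, Ne, Int.cast_inj]
        exact fun h => hst (Subtype.ext h)
      have hne' : ((s : ℤ) : ℂ) - ((t : ℤ) : ℂ) = -(((t : ℤ) : ℂ) - ((s : ℤ) : ℂ)) := by ring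
      simp only [F, G, H, D, Prod.swap, if_neg hst, add_zero, hne']
      field_simp
      ring
  have hKa := ha.summable_norm_odd_div hp n
  have hKb := hb.summable_norm_odd_div hp n
  have hF : Summable F := by
    have hF' := summable_mul_of_summable_norm hKa hKb
    simpa only [F] using hF'
  have hG : Summable G := ha.summable_odd_div_mul_div_sub hp hb n
  have hH : Summable fun x : {m : ℤ // Odd m} × {m : ℤ // Odd m} => H x.swap :=
    (hb.summable_odd_div_mul_div_sub hp ha n).prod_symm
  have hD : Summable D := ((hF.sub hG).sub hH).congr fun x => by rw [hdecomp]; ring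
  have hFsum : KT a n * KT b n = (4 / (Real.pi : ℂ) ^ 2) * ∑' x, F x := by
    rw [KT, KT, ← tsum_mul_tsum_of_summable_norm hKa hKb]
    ring
  have hHsum : KT (fun m => HT a m * b m) n = (4 / (Real.pi : ℂ) ^ 2) *
      ∑' x : {m : ℤ // Odd m} × {m : ℤ // Odd m}, H x.swap := by
    have hswap := (Equiv.prodComm {m : ℤ // Odd m} {m : ℤ // Odd m}).tsum_eq H
    simp only [Equiv.prodComm_apply] at hswap
    rw [hswap, ← KT_mul_HT_eq_tsum_prod hp hb ha]
    simp only [mul_comm]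
  have hDsum : IT (fun m => a m * b m) n = (4 / (Real.pi : ℂ) ^ 2) * ∑' x, D x := by
    rw [hD.tsum_prod, IT]
    congr 1
    refine tsum_congr fun s => ?_
    simp only [D, tsum_ite_eq]
  rw [hFsum, hHsum, hDsum, KT_mul_HT_eq_tsum_prod hp ha hb, tsum_congr hdecomp,
    (hG.add hH).tsum_add hD, hG.tsum_add hH, mul_add, mul_add]

end
end

section
/- For every nonzero even integer j, one has Σ_{m ∈ 2ℤ+1} 1/(m²(j − m)) = π²/(4j), where the sum is over all odd integers m and converges absolutely. -/
open scoped BigOperators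
open MeasureTheory

noncomputable section

theorem hasSum_one_div_odd_sq_nat :
    HasSum (fun n : ℕ => 1 / (2 * (n : ℝ) + 1) ^ 2) (Real.pi ^ 2 / 8) := by
  have h_even : HasSum (fun n : ℕ => (1 : ℝ) / ((2 * n : ℕ) : ℝ) ^ 2)
      (1 / 4 * (Real.pi ^ 2 / 6)) := by
    have h_term : ∀ n : ℕ, (1 : ℝ) / ((2 * n : ℕ) : ℝ) ^ 2 = 1 / 4 * (1 / (n : ℝ) ^ 2) := by
      intro n
      push_cast
      ring
    simpa only [h_term] using hasSum_zeta_two.mul_left (1 / 4 : ℝ)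
  have h_inj : Function.Injective (fun n : ℕ => 2 * n + 1) := fun a b hab => by
    dsimp only at hab
    omega
  have h_odd : Summable (fun n : ℕ => (1 : ℝ) / ((2 * n + 1 : ℕ) : ℝ) ^ 2) :=
    hasSum_zeta_two.summable.comp_injective h_inj
  have h_total := (HasSum.even_add_odd (f := fun n : ℕ => (1 : ℝ) / (n : ℝ) ^ 2)
    h_even h_odd.hasSum).unique hasSum_zeta_two
  have h_value : ∑' n : ℕ, (1 : ℝ) / ((2 * n + 1 : ℕ) : ℝ) ^ 2 = Real.pi ^ 2 / 8 := by
    linarith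
  have h := h_odd.hasSum
  rw [h_value] at h
  simpa only [Nat.cast_add, Nat.cast_mul, Nat.cast_ofNat, Nat.cast_one] using h

theorem hasSum_one_div_odd_sq_int :
    HasSum (fun n : ℤ => 1 / (2 * (n : ℝ) + 1) ^ 2) (Real.pi ^ 2 / 4) := by
  have h := hasSum_one_div_odd_sq_nat
  convert! HasSum.of_nat_of_neg_add_one (f := fun n : ℤ => 1 / (2 * (n : ℝ) + 1) ^ 2)
    (m := Real.pi ^ 2 / 8) (m' := Real.pi ^ 2 / 8) ?_ ?_ using 1
  · ring
  · simpa using h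
  · convert! h using 1
    funext n
    push_cast
    ring

theorem hasSum_one_div_odd_sub_succ_nat :
    HasSum (fun n : ℕ => 1 / (2 * (n : ℝ) + 1) - 1 / (2 * (n : ℝ) + 3)) 1 := by
  rw [hasSum_iff_tendsto_nat_of_nonneg]
  · have h_partial : ∀ N : ℕ, ∑ n ∈ Finset.range N,
        (1 / (2 * (n : ℝ) + 1) - 1 / (2 * (n : ℝ) + 3)) = 1 - 1 / (2 * (N : ℝ) + 1) := by
      intro N
      induction N with
      | zero => simp
      | succ N ih =>
        rw [Finset.sum_range_succ, ih]
        push_cast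
        ring
    simp only [h_partial]
    have h_lim : Filter.Tendsto (fun N : ℕ => 2 * (N : ℝ) + 1) Filter.atTop Filter.atTop :=
      Filter.tendsto_atTop_add_const_right _ _
        (tendsto_natCast_atTop_atTop.const_mul_atTop two_pos)
    simpa using h_lim.inv_tendsto_atTop.const_sub 1
  · intro n
    rw [sub_nonneg]
    gcongr
    norm_num

theorem hasSum_one_div_odd_sub_pred_int :
    HasSum (fun n : ℤ => 1 / (2 * (n : ℝ) + 1) - 1 / (2 * ((n - 1 : ℤ) : ℝ) + 1)) 0 := by
  have h := hasSum_one_div_odd_sub_succ_nat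
  convert! HasSum.of_nat_of_neg_add_one
    (f := fun n : ℤ => 1 / (2 * (n : ℝ) + 1) - 1 / (2 * ((n - 1 : ℤ) : ℝ) + 1))
    (m := 1) (m' := -1) ?_ ?_ using 1
  · ring
  · rw [← hasSum_nat_add_iff' 1]
    convert! h.neg using 1
    · funext n
      push_cast
      ring
    · norm_num
  · convert! h.neg using 1
    funext n
    have h1 : (2 * (n : ℝ) + 1) ≠ 0 := by positivity
    have h3 : (2 * (n : ℝ) + 3) ≠ 0 := by positivity
    push_cast
    rw [show 2 * (-((n : ℝ) + 1)) + 1 = -(2 * n + 1) by ring,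
      show 2 * (-((n : ℝ) + 1) - 1) + 1 = -(2 * n + 3) by ring]
    field_simp
    ring

/-- If the backward differences of `h` sum to zero over `ℤ`, so do those of every step `k`. -/
theorem hasSum_sub_shift_of_hasSum_sub_pred {h : ℤ → ℝ}
    (hs : HasSum (fun n => h n - h (n - 1)) 0) (k : ℤ) :
    HasSum (fun n => h n - h (n - k)) 0 := by
  induction k using Int.induction_on with
  | zero => simp
  | succ k ih =>
    simpa [Function.comp_def, sub_sub] using
      ih.add ((Equiv.subRight (k : ℤ)).hasSum_iff.mpr hs)
  | pred k ih =>
    have h_shift := ih.sub ((Equiv.subRight (-(k : ℤ) - 1)).hasSum_iff.mpr hs)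
    convert! h_shift using 1
    · funext n
      simp only [Function.comp_apply, Equiv.subRight_apply]
      rw [show n - (-(k : ℤ) - 1) - 1 = n - -(k : ℤ) by ring]
      ring
    · ring

/-- The parametrization `n ↦ 2 * n + 1` of the odd integers. -/
def intEquivOdd : ℤ ≃ {m : ℤ // Odd m} where
  toFun n := ⟨2 * n + 1, n, rfl⟩
  invFun m := (m : ℤ) / 2
  left_inv n := by
    dsimp only
    omega
  right_inv m := by
    obtain ⟨m, n, rfl⟩ := m
    ext
    dsimp only
    omega

theorem hasSum_odd_one_div_sq_mul_sub {j : ℤ} (hj : j ≠ 0) (hje : Even j) :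
    HasSum (fun m : {m : ℤ // Odd m} => 1 / (((m : ℤ) : ℝ) ^ 2 * ((j : ℝ) - ((m : ℤ) : ℝ))))
      (Real.pi ^ 2 / (4 * (j : ℝ))) := by
  obtain ⟨k, rfl⟩ := hje
  have h_sq := hasSum_one_div_odd_sq_int
  have h_shift := hasSum_sub_shift_of_hasSum_sub_pred
    (h := fun n : ℤ => 1 / (2 * (n : ℝ) + 1)) hasSum_one_div_odd_sub_pred_int k
  have h_j : ((k + k : ℤ) : ℝ) ≠ 0 := by exact_mod_cast hj
  rw [← intEquivOdd.hasSum_iff]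
  convert! (h_sq.mul_left (1 / ((k + k : ℤ) : ℝ))).add
    (h_shift.mul_left (1 / ((k + k : ℤ) : ℝ) ^ 2)) using 1
  · funext n
    have h_odd : (2 * (n : ℝ) + 1) ≠ 0 := by
      have : (2 * n + 1 : ℤ) ≠ 0 := by omega
      exact_mod_cast this
    have h_sub : ((k : ℝ) + k - (2 * n + 1)) ≠ 0 := by
      have : (k + k - (2 * n + 1) : ℤ) ≠ 0 := by omega
      exact_mod_cast this
    have h_k : (k : ℝ) + k ≠ 0 := by exact_mod_cast hj
    simp only [Function.comp_apply, intEquivOdd, Equiv.coe_fn_mk]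
    push_cast
    rw [show 2 * ((n : ℝ) - k) + 1 = -((k : ℝ) + k - (2 * n + 1)) by ring]
    generalize ha : 2 * (n : ℝ) + 1 = a at *
    generalize hb : (k : ℝ) + k = b at *
    field_simp
    ring
  · field_simp
    ring

/-- For nonzero even j, Σ_{m odd} 1/(m²(j - m)) = π²/(4j), with absolute convergence. -/
theorem odd_sum_eval (j : ℤ) (hj : j ≠ 0) (hje : Even j) :
    (Summable fun m : {m : ℤ // Odd m} =>
      |1 / (((m : ℤ) : ℝ) ^ 2 * ((j : ℝ) - ((m : ℤ) : ℝ)))|) ∧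
    ∑' m : {m : ℤ // Odd m}, 1 / (((m : ℤ) : ℝ) ^ 2 * ((j : ℝ) - ((m : ℤ) : ℝ))) =
      Real.pi ^ 2 / (4 * (j : ℝ)) := by
  have h := hasSum_odd_one_div_sq_mul_sub hj hje
  exact ⟨h.summable.abs, h.tsum_eq⟩

end
end
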